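/- Let (T, τ) be an n-cyclic counter and (S, σ) be an m-cyclic counter (n, m positive integers), and let s₀ ∈ S. Then the hybrid counter (T, τ) ⊕_{s₀} (S, σ), defined on the Cartesian product T × S by the increment (τ ⊕_{s₀} σ)((t, s)) = (τ(t), σ(s)) if s = s₀ and (t, σ(s)) if s ≠ s₀, is an mn-cyclic counter. -/

import Mathlib

/-- A counter `(α, σ)` is `n`-cyclic if `α` is finite with `n` elements and there is a
generator `s₀` from which every state is reachable by iterating `σ`, and which recurs
after some positive number of steps. -/
def IsNCyclic {α : Type*} (σ : α → α) (n : ℕ) : Prop :=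
  Finite α ∧ Nat.card α = n ∧
    ∃ s₀ : α, (∀ t : α, ∃ i : ℕ, σ^[i] s₀ = t) ∧ ∃ m : ℕ, 0 < m ∧ σ^[m] s₀ = s₀

/-- The hybrid counter (T, τ) ⊕_{s₀} (S, σ): increments σ every step, and increments τ
exactly when the σ-component equals s₀. -/
def hybrid {α β : Type*} [DecidableEq β] (τ : α → α) (σ : β → β) (s₀ : β) :
    α × β → α × β :=
  fun p => if p.2 = s₀ then (τ p.1, σ p.2) else (p.1, σ p.2)

open Function in
/-- In a cyclic counter every state is periodic. -/
theorem IsNCyclic.mem_periodicPts {α : Type*} {σ : α → α} {n : ℕ} (h : IsNCyclic σ n) (x : α) :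
    x ∈ periodicPts σ := by
  obtain ⟨-, -, g, hg, m, hm, hmg⟩ := h
  obtain ⟨i, rfl⟩ := hg x
  exact ⟨m, hm, IsPeriodicPt.apply_iterate hmg i⟩

open Function in
/-- In a cyclic counter every state is reachable from every other one. -/
theorem IsNCyclic.exists_iterate_eq {α : Type*} {σ : α → α} {n : ℕ} (h : IsNCyclic σ n)
    (x y : α) : ∃ i, σ^[i] x = y := by
  obtain ⟨-, -, g, hg, m, hm, hmg⟩ := h
  obtain ⟨i, rfl⟩ := hg x
  obtain ⟨j, rfl⟩ := hg y
  have hi : i ≤ m * i := Nat.le_mul_of_pos_left i hm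
  refine ⟨j + (m * i - i), ?_⟩
  rw [← iterate_add_apply, show j + (m * i - i) + i = j + m * i by omega, iterate_add_apply,
    IsPeriodicPt.mul_const hmg i]

open Function in
/-- Until `σ` returns to `s₀`, the hybrid counter started at `s₀` increments `τ` only once. -/
theorem hybrid_iterate_succ {α β : Type*} [DecidableEq β] (τ : α → α) (σ : β → β) (s₀ : β)
    (t : α) {j : ℕ} (hj : j < minimalPeriod σ s₀) :
    (hybrid τ σ s₀)^[j + 1] (t, s₀) = (τ t, σ^[j + 1] s₀) := by
  induction j with
  | zero => simp [hybrid]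
  | succ j ih =>
    have hne : σ^[j + 1] s₀ ≠ s₀ :=
      not_isPeriodicPt_of_pos_of_lt_minimalPeriod j.succ_ne_zero hj
    rw [iterate_succ_apply', ih (by omega), iterate_succ_apply' σ (j + 1), hybrid, if_neg hne]

open Function in
/-- Each full cycle of `σ` from `s₀` increments `τ` exactly once. -/
theorem hybrid_iterate_minimalPeriod_mul {α β : Type*} [DecidableEq β] (τ : α → α) (σ : β → β)
    {s₀ : β} (hs : s₀ ∈ periodicPts σ) (t : α) (k : ℕ) :
    (hybrid τ σ s₀)^[minimalPeriod σ s₀ * k] (t, s₀) = (τ^[k] t, s₀) := by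
  have hp := minimalPeriod_pos_of_mem_periodicPts hs
  have hcycle (u : α) : (hybrid τ σ s₀)^[minimalPeriod σ s₀] (u, s₀) = (τ u, s₀) := by
    have h := hybrid_iterate_succ τ σ s₀ u (Nat.sub_lt hp one_pos)
    rwa [Nat.sub_one_add_one hp.ne', iterate_minimalPeriod] at h
  induction k with
  | zero => rfl
  | succ k ih =>
    rw [Nat.mul_succ, Nat.add_comm, iterate_add_apply, ih, hcycle, iterate_succ_apply']

/-- The hybrid of an n-cyclic counter and an m-cyclic counter is mn-cyclic. -/
theorem hybrid_ncyclic {α β : Type*} [DecidableEq β] (τ : α → α) (σ : β → β)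
    (n m : ℕ) (hn : 0 < n) (hm : 0 < m) (s₀ : β)
    (hτ : IsNCyclic τ n) (hσ : IsNCyclic σ m) :
    IsNCyclic (hybrid τ σ s₀) (m * n) := by
  have hs := hσ.mem_periodicPts s₀
  have hp := Function.minimalPeriod_pos_of_mem_periodicPts hs
  obtain ⟨hα, hαn, t₀, -, a, ha, hat⟩ := id hτ
  obtain ⟨hβ, hβm, -⟩ := id hσ
  refine ⟨inferInstance, by rw [Nat.card_prod, hαn, hβm, mul_comm], (t₀, s₀), ?_,
    Function.minimalPeriod σ s₀ * a, Nat.mul_pos hp ha, ?_⟩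
  · rintro ⟨t, s⟩
    obtain ⟨k, hk⟩ := hτ.exists_iterate_eq (τ t₀) t
    obtain ⟨i, hi⟩ := hσ.exists_iterate_eq (σ s₀) s
    refine ⟨i % Function.minimalPeriod σ s₀ + 1 + Function.minimalPeriod σ s₀ * k, ?_⟩
    rw [Function.iterate_add_apply, hybrid_iterate_minimalPeriod_mul τ σ hs,
      hybrid_iterate_succ τ σ s₀ _ (Nat.mod_lt i hp), ← Function.iterate_succ_apply' τ,
      Function.iterate_succ_apply, hk, Function.iterate_succ_apply,
      ← Function.minimalPeriod_apply hs, Function.iterate_mod_minimalPeriod_eq, hi]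
  · rw [hybrid_iterate_minimalPeriod_mul τ σ hs, hat]
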